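/- arXiv:1408.1886 — 2 statements merged into one kernel-verified Lean document; each statement's English description precedes it below -/
import Mathlib

section
/- Fix an integer m ≥ 1. Let rₘ(n) be the number of permutations of [n] whose descent set is exactly {m, 2m, …, n−m} when m divides n (so rₘ(0)=1), and rₘ(n)=0 when m does not divide n; equivalently, rₘ(n) is the number of permutations of [n] all of whose increasing runs have length exactly m. Then in ℚ⟦X⟧: (Σ_{k=0}^∞ (−1)ᵏ·X^{mk}/(mk)!) · (Σ_{n=0}^∞ rₘ(n)·Xⁿ/n!) = 1. -/
/-- The entry of the permutation `σ` of `[n]` at (1-based) position `i`,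
as a value in `{1, …, n}`; `0` if `i` is out of range. -/
def permEnt {n : ℕ} (σ : Equiv.Perm (Fin n)) (i : ℕ) : ℕ :=
  if h : 1 ≤ i ∧ i ≤ n then (σ ⟨i - 1, by omega⟩ : ℕ) + 1 else 0

/-- `i` is a descent of `σ`: `1 ≤ i ≤ n−1` and `π_i > π_{i+1}`. -/
def IsDescent {n : ℕ} (σ : Equiv.Perm (Fin n)) (i : ℕ) : Prop :=
  1 ≤ i ∧ i < n ∧ permEnt σ (i + 1) < permEnt σ i

/-- `i` is an alternating descent of `σ`: `i` odd with `π_i > π_{i+1}`,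
or `i` even with `π_i < π_{i+1}`. -/
def IsAltDescent {n : ℕ} (σ : Equiv.Perm (Fin n)) (i : ℕ) : Prop :=
  1 ≤ i ∧ i < n ∧
    ((i % 2 = 1 ∧ permEnt σ (i + 1) < permEnt σ i) ∨
     (i % 2 = 0 ∧ permEnt σ i < permEnt σ (i + 1)))

instance {n : ℕ} (σ : Equiv.Perm (Fin n)) (i : ℕ) : Decidable (IsDescent σ i) := by
  unfold IsDescent; infer_instance

instance {n : ℕ} (σ : Equiv.Perm (Fin n)) (i : ℕ) : Decidable (IsAltDescent σ i) := by
  unfold IsAltDescent; infer_instance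

/-- `i` is a peak of `σ`: `2 ≤ i ≤ n−1` and `π_{i−1} < π_i > π_{i+1}`. -/
def IsPeak {n : ℕ} (σ : Equiv.Perm (Fin n)) (i : ℕ) : Prop :=
  2 ≤ i ∧ i < n ∧ permEnt σ (i - 1) < permEnt σ i ∧ permEnt σ (i + 1) < permEnt σ i

/-- `i` is a valley of `σ`: `2 ≤ i ≤ n−1` and `π_{i−1} > π_i < π_{i+1}`. -/
def IsValley {n : ℕ} (σ : Equiv.Perm (Fin n)) (i : ℕ) : Prop :=
  2 ≤ i ∧ i < n ∧ permEnt σ i < permEnt σ (i - 1) ∧ permEnt σ i < permEnt σ (i + 1)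

/-- All valleys of `σ` are even and all peaks of `σ` are odd. -/
def GoodPerm {n : ℕ} (σ : Equiv.Perm (Fin n)) : Prop :=
  (∀ i, IsValley σ i → i % 2 = 0) ∧ (∀ i, IsPeak σ i → i % 2 = 1)

/-- `f n` is the number of permutations of `[n]` with all valleys even and all peaks odd. -/
noncomputable def fCount (n : ℕ) : ℕ :=
  Nat.card {σ : Equiv.Perm (Fin n) // GoodPerm σ}

/-- `g n` is the number of permutations of `[n]` with all valleys even and all peaks odd
having no descent at position `n − 1`. -/
noncomputable def gCount (n : ℕ) : ℕ :=
  Nat.card {σ : Equiv.Perm (Fin n) // GoodPerm σ ∧ ¬ IsDescent σ (n - 1)}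

/-- `σ` is an alternating permutation: `π₁ > π₂ < π₃ > π₄ < ⋯`. -/
def IsAltPerm {n : ℕ} (σ : Equiv.Perm (Fin n)) : Prop :=
  ∀ i, 1 ≤ i → i < n →
    (i % 2 = 1 → permEnt σ (i + 1) < permEnt σ i) ∧
    (i % 2 = 0 → permEnt σ i < permEnt σ (i + 1))

/-- The Euler number `Eₙ`, the number of alternating permutations of `[n]`. -/
noncomputable def eulerNum (n : ℕ) : ℕ :=
  Nat.card {σ : Equiv.Perm (Fin n) // IsAltPerm σ}

/-- `rCount m n`: the number of permutations of `[n]` whose descent set is exactly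
`{m, 2m, …, n−m}` when `m ∣ n`, and `0` otherwise; equivalently, the number of
permutations of `[n]` all of whose increasing runs have length exactly `m`. -/
noncomputable def rCount (m n : ℕ) : ℕ :=
  if m ∣ n then
    Nat.card {σ : Equiv.Perm (Fin n) // ∀ i, IsDescent σ i ↔ (1 ≤ i ∧ i < n ∧ m ∣ i)}
  else 0

/-- position `i` is a descent, without range conditions -/
def dsc {n : ℕ} (σ : Equiv.Perm (Fin n)) (i : ℕ) : Prop :=
  permEnt σ (i + 1) < permEnt σ i

/-- block sum of two permutations -/
def blk {a b : ℕ} (α : Equiv.Perm (Fin a)) (β : Equiv.Perm (Fin b)) : Equiv.Perm (Fin (a + b)) :=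
  finSumFinEquiv.permCongr (Equiv.sumCongr α β)

theorem blk_castAdd {a b : ℕ} (α : Equiv.Perm (Fin a)) (β : Equiv.Perm (Fin b)) (i : Fin a) :
    blk α β (Fin.castAdd b i) = Fin.castAdd b (α i) := by
  simp [blk, Equiv.permCongr_apply]

theorem blk_natAdd {a b : ℕ} (α : Equiv.Perm (Fin a)) (β : Equiv.Perm (Fin b)) (i : Fin b) :
    blk α β (Fin.natAdd a i) = Fin.natAdd a (β i) := by
  simp [blk, Equiv.permCongr_apply]

/-- shuffles -/
def Shf (a b : ℕ) : Type :=
  {τ : Equiv.Perm (Fin (a + b)) //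
    StrictMono (fun i => τ (Fin.castAdd b i)) ∧ StrictMono (fun i => τ (Fin.natAdd a i))}

/-- the decomposition map -/
def shfMap (a b : ℕ) (x : Shf a b × (Equiv.Perm (Fin a) × Equiv.Perm (Fin b))) :
    Equiv.Perm (Fin (a + b)) := x.1.1 * blk x.2.1 x.2.2

theorem perm_ext_blk {a b : ℕ} {σ τ : Equiv.Perm (Fin (a + b))}
    (h1 : ∀ i, σ (Fin.castAdd b i) = τ (Fin.castAdd b i))
    (h2 : ∀ i, σ (Fin.natAdd a i) = τ (Fin.natAdd a i)) : σ = τ := by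
  ext i
  refine Fin.addCases (fun i => ?_) (fun i => ?_) i
  · rw [h1]
  · rw [h2]

theorem range_eq_of_perm {ι γ : Type*} {f g : ι → γ} (s t : Equiv.Perm ι)
    (h : ∀ i, f (s i) = g (t i)) : Set.range f = Set.range g := by
  have : f ∘ s = g ∘ t := funext h
  rw [← s.surjective.range_comp f, this, t.surjective.range_comp g]

theorem shfMap_bij (a b : ℕ) : Function.Bijective (shfMap a b) := by
  constructor
  · rintro ⟨⟨τ, h1, h2⟩, α, β⟩ ⟨⟨τ', h1', h2'⟩, α', β'⟩ h
    simp only [shfMap] at h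
    have e1 : ∀ i, τ (Fin.castAdd b (α i)) = τ' (Fin.castAdd b (α' i)) := by
      intro i
      have := congrArg (fun s => s (Fin.castAdd b i)) h
      simpa [Equiv.Perm.mul_apply, blk_castAdd] using this
    have e2 : ∀ i, τ (Fin.natAdd a (β i)) = τ' (Fin.natAdd a (β' i)) := by
      intro i
      have := congrArg (fun s => s (Fin.natAdd a i)) h
      simpa [Equiv.Perm.mul_apply, blk_natAdd] using this
    have f1 := (h1.range_inj h1').1 (range_eq_of_perm α α' e1)
    have f2 := (h2.range_inj h2').1 (range_eq_of_perm β β' e2)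
    have ht : τ = τ' := perm_ext_blk (congrFun f1) (congrFun f2)
    subst ht
    have ha : α = α' := by
      ext i
      have := τ.injective (e1 i)
      simpa using congrArg Fin.val this
    have hb : β = β' := by
      ext i
      have := τ.injective (e2 i)
      simpa using congrArg Fin.val this
    subst ha hb
    rfl
  · intro σ
    let s := Tuple.sort (fun i => σ (Fin.castAdd b i))
    let t := Tuple.sort (fun i => σ (Fin.natAdd a i))
    have hs := Tuple.monotone_sort (fun i => σ (Fin.castAdd b i))
    have ht := Tuple.monotone_sort (fun i => σ (Fin.natAdd a i))
    refine ⟨⟨⟨σ * blk s t, ?_, ?_⟩, s⁻¹, t⁻¹⟩, ?_⟩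
    · simp only [Equiv.Perm.mul_apply, blk_castAdd]
      refine hs.strictMono_of_injective ?_
      intro i j hij
      simpa using hij
    · simp only [Equiv.Perm.mul_apply, blk_natAdd]
      refine ht.strictMono_of_injective ?_
      intro i j hij
      simpa using hij
    · apply perm_ext_blk <;> intro i <;>
        simp [shfMap, Equiv.Perm.mul_apply, blk_castAdd, blk_natAdd]

theorem dsc_iff {n : ℕ} (σ : Equiv.Perm (Fin n)) (i : ℕ) (h : i + 1 < n) :
    dsc σ (i + 1) ↔ σ ⟨i + 1, h⟩ < σ ⟨i, by omega⟩ := by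
  unfold dsc permEnt
  rw [dif_pos (by omega), dif_pos (by omega)]
  rw [Fin.lt_def]
  exact Nat.add_lt_add_iff_right

theorem dsc_left {a b : ℕ} (τ : Shf a b) (α : Equiv.Perm (Fin a)) (β : Equiv.Perm (Fin b))
    (i : ℕ) (h1 : 1 ≤ i) (h2 : i < a) : dsc (τ.1 * blk α β) i ↔ dsc α i := by
  obtain ⟨i, rfl⟩ : ∃ k, i = k + 1 := ⟨i - 1, by omega⟩
  rw [dsc_iff _ _ (by omega), dsc_iff _ _ h2]
  have e := fun x => blk_castAdd α β x
  have e1 := e ⟨i + 1, h2⟩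
  have e2 := e ⟨i, by omega⟩
  simp only [Fin.castAdd_mk] at e1 e2
  rw [Equiv.Perm.mul_apply, Equiv.Perm.mul_apply, e1, e2]
  exact τ.2.1.lt_iff_lt

theorem dsc_right {a b : ℕ} (τ : Shf a b) (α : Equiv.Perm (Fin a)) (β : Equiv.Perm (Fin b))
    (i : ℕ) (h1 : 1 ≤ i) (h2 : i < b) : dsc (τ.1 * blk α β) (a + i) ↔ dsc β i := by
  obtain ⟨i, rfl⟩ : ∃ k, i = k + 1 := ⟨i - 1, by omega⟩
  rw [← add_assoc, dsc_iff _ _ (by omega), dsc_iff _ _ h2]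
  have e := fun x => blk_natAdd α β x
  have e1 := e ⟨i + 1, h2⟩
  have e2 := e ⟨i, by omega⟩
  simp only [Fin.natAdd_mk, ← add_assoc] at e1 e2
  rw [Equiv.Perm.mul_apply, Equiv.Perm.mul_apply, e1, e2]
  exact τ.2.2.lt_iff_lt

theorem eq_one_iff {n : ℕ} (β : Equiv.Perm (Fin n)) :
    β = 1 ↔ ∀ i, 1 ≤ i → i < n → ¬ dsc β i := by
  constructor
  · rintro rfl i h1 h2
    obtain ⟨i, rfl⟩ : ∃ k, i = k + 1 := ⟨i - 1, by omega⟩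
    rw [dsc_iff _ _ h2]
    simp [Fin.lt_def]
  · intro h
    have hm : StrictMono β := by
      cases n with
      | zero => intro i; exact i.elim0
      | succ n =>
        rw [Fin.strictMono_iff_lt_succ]
        intro i
        have := h (i + 1) (by omega) (by omega)
        rw [dsc_iff _ _ (by omega), not_lt] at this
        refine lt_of_le_of_ne this ?_
        intro hc
        have := β.injective hc
        simp [Fin.ext_iff] at this
    have := (hm.range_inj strictMono_id).1 (by simp [β.surjective.range_eq])
    ext i
    simp [this]

/-- permutations of `[n]` with prescribed descents -/
def Rset (m n : ℕ) (σ : Equiv.Perm (Fin n)) : Prop :=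
  ∀ i, 1 ≤ i → i < n → (dsc σ i ↔ m ∣ i)

/-- prescribed descents in the first `a` letters, increasing afterwards -/
def Xset (m n a : ℕ) (σ : Equiv.Perm (Fin n)) : Prop :=
  (∀ i, 1 ≤ i → i < a → (dsc σ i ↔ m ∣ i)) ∧ ∀ i, a < i → i < n → ¬ dsc σ i

theorem Xset_shf {m a b : ℕ} (x : Shf a b × (Equiv.Perm (Fin a) × Equiv.Perm (Fin b))) :
    Xset m (a + b) a (shfMap a b x) ↔ Rset m a x.2.1 ∧ x.2.2 = 1 := by
  obtain ⟨τ, α, β⟩ := x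
  simp only [shfMap, Xset, Rset, eq_one_iff]
  refine and_congr ?_ ?_
  · refine forall_congr' fun i => forall_congr' fun h1 => forall_congr' fun h2 => ?_
    rw [dsc_left τ α β i h1 h2]
  · constructor
    · intro h i h1 h2
      rw [← dsc_right τ α β i h1 h2]
      exact h _ (by omega) (by omega)
    · intro h i h1 h2
      obtain ⟨j, rfl⟩ : ∃ j, i = a + j := ⟨i - a, by omega⟩
      rw [dsc_right τ α β j (by omega) (by omega)]
      exact h _ (by omega) (by omega)

theorem card_shf (a b : ℕ) :
    Nat.card (Shf a b) * (a.factorial * b.factorial) = (a + b).factorial := by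
  have := Nat.card_eq_of_bijective _ (shfMap_bij a b)
  simpa [Nat.card_prod, Fintype.card_perm] using this

theorem card_X (m a b : ℕ) :
    Nat.card {σ // Xset m (a + b) a σ} = Nat.card (Shf a b) * Nat.card {σ // Rset m a σ} := by
  rw [← Nat.card_prod]
  symm
  refine Nat.card_congr (Equiv.trans ?_
    ((Equiv.ofBijective _ (shfMap_bij a b)).subtypeEquiv
      (p := fun x => Rset m a x.2.1 ∧ x.2.2 = 1) ?_))
  · exact
      { toFun := fun x => ⟨(x.1, x.2.1, 1), x.2.2, rfl⟩
        invFun := fun x => (x.1.1, ⟨x.1.2.1, x.2.1⟩)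
        left_inv := fun x => rfl
        right_inv := by
          rintro ⟨⟨τ, α, β⟩, h1, h2⟩
          simp only at h2
          subst h2
          rfl }
  · intro x
    exact Xset_shf x |>.symm

theorem rCount_eq {m n : ℕ} (h : m ∣ n) : rCount m n = Nat.card {σ // Rset m n σ} := by
  rw [rCount, if_pos h]
  refine Nat.card_congr (Equiv.subtypeEquivRight fun σ => ?_)
  simp only [Rset, IsDescent, dsc]
  refine forall_congr' fun i => ?_
  tauto

theorem term_eq {m n a b : ℕ} (h : a + b = n) (ha : m ∣ a) :
    1 / (b.factorial : ℚ) * (rCount m a / a.factorial) =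
      Nat.card {σ // Xset m n a σ} / n.factorial := by
  subst h
  rw [card_X, rCount_eq ha, ← card_shf]
  have h1 : (a.factorial : ℚ) ≠ 0 := by positivity
  have h2 : (b.factorial : ℚ) ≠ 0 := by positivity
  have h3 : (Nat.card (Shf a b) : ℚ) ≠ 0 := by
    have := card_shf a b
    intro hc
    have hc : Nat.card (Shf a b) = 0 := by exact_mod_cast hc
    rw [hc, zero_mul] at this
    exact (Nat.factorial_pos _).ne this
  push_cast
  field_simp

/-- descents exactly at the multiples of `m` less than `m * j` -/
def Dset (m n j : ℕ) (σ : Equiv.Perm (Fin n)) : Prop :=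
  ∀ i, 1 ≤ i → i < n → (dsc σ i ↔ m ∣ i ∧ i < m * j)

/-- truncated counts -/
noncomputable def Ecnt (m N j : ℕ) : ℕ :=
  if 1 ≤ j ∧ j ≤ N then Nat.card {σ // Dset m (m * N) j σ} else 0

theorem mult_lt {m i j : ℕ} (h : m ∣ i) (h2 : i < m * (j + 1)) : i ≤ m * j := by
  obtain ⟨k, rfl⟩ := h
  have : k < j + 1 := lt_of_mul_lt_mul_left h2 (Nat.zero_le _)
  exact Nat.mul_le_mul_left _ (by omega)

theorem Xset_iff_D {m n j : ℕ} (hm : 1 ≤ m) (σ : Equiv.Perm (Fin n)) (hj : 1 ≤ j)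
    (hn : m * j < n) :
    Xset m n (m * j) σ ↔ Dset m n j σ ∨ Dset m n (j + 1) σ := by
  have hpos : 1 ≤ m * j := Nat.mul_pos hm hj
  have hlt : m * j < m * (j + 1) := Nat.mul_lt_mul_of_pos_left (by omega) hm
  constructor
  · rintro ⟨h1, h2⟩
    by_cases hd : dsc σ (m * j)
    · right
      intro i hi hi'
      rcases lt_trichotomy i (m * j) with h | h | h
      · rw [h1 i hi h]
        exact ⟨fun h' => ⟨h', by omega⟩, fun h' => h'.1⟩
      · subst h
        exact ⟨fun _ => ⟨dvd_mul_right _ _, hlt⟩, fun _ => hd⟩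
      · refine ⟨fun h' => absurd h' (h2 i h hi'), fun h' => ?_⟩
        have := mult_lt h'.1 h'.2
        omega
    · left
      intro i hi hi'
      rcases lt_trichotomy i (m * j) with h | h | h
      · rw [h1 i hi h]
        exact ⟨fun h' => ⟨h', by omega⟩, fun h' => h'.1⟩
      · subst h
        exact ⟨fun h' => absurd h' hd, fun h' => absurd h'.2 (lt_irrefl _)⟩
      · exact ⟨fun h' => absurd h' (h2 i h hi'), fun h' => by omega⟩
  · rintro (h | h)
    · refine ⟨fun i hi hi' => ?_, fun i hi hi' => ?_⟩
      · rw [h i hi (by omega)]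
        exact ⟨fun h' => h'.1, fun h' => ⟨h', hi'⟩⟩
      · rw [h i (by omega) hi']
        omega
    · refine ⟨fun i hi hi' => ?_, fun i hi hi' => ?_⟩
      · rw [h i hi (by omega)]
        exact ⟨fun h' => h'.1, fun h' => ⟨h', by omega⟩⟩
      · rw [h i (by omega) hi']
        rintro ⟨h3, h4⟩
        have := mult_lt h3 h4
        omega

theorem D_disj {m n j : ℕ} (hm : 1 ≤ m) (σ : Equiv.Perm (Fin n)) (hj : 1 ≤ j)
    (hn : m * j < n) : ¬ (Dset m n j σ ∧ Dset m n (j + 1) σ) := by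
  rintro ⟨h1, h2⟩
  have hpos : 1 ≤ m * j := Nat.mul_pos hm hj
  have hlt : m * j < m * (j + 1) := Nat.mul_lt_mul_of_pos_left (by omega) hm
  have h3 := (h2 _ hpos hn).2 ⟨dvd_mul_right _ _, hlt⟩
  exact absurd ((h1 _ hpos hn).1 h3).2 (lt_irrefl _)

theorem X_eq_E {m N j : ℕ} (hm : 1 ≤ m) (hN : 1 ≤ N) (hj : j ≤ N) :
    Nat.card {σ // Xset m (m * N) (m * j) σ} = Ecnt m N j + Ecnt m N (j + 1) := by
  rcases Nat.eq_zero_or_pos j with rfl | hj0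
  · rw [Ecnt, Ecnt, if_neg (by omega), if_pos (by omega), zero_add]
    refine Nat.card_congr (Equiv.subtypeEquivRight fun σ => ?_)
    simp only [Xset, Dset]
    constructor
    · rintro ⟨_, h⟩ i hi hi'
      refine ⟨fun h' => absurd h' (h i (by omega) hi'), fun h' => ?_⟩
      have := mult_lt h'.1 h'.2
      omega
    · intro h
      refine ⟨fun i hi hi' => by simp at hi', fun i hi hi' hd => ?_⟩
      have h' := (h i (by omega) hi').1 hd
      have := mult_lt h'.1 h'.2
      omega
  · rcases hj.eq_or_lt with rfl | hlt
    · rw [Ecnt, Ecnt, if_pos (by omega), if_neg (by omega), add_zero]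
      refine Nat.card_congr (Equiv.subtypeEquivRight fun σ => ?_)
      simp only [Xset, Dset]
      constructor
      · rintro ⟨h, _⟩ i hi hi'
        rw [h i hi hi']
        tauto
      · intro h
        refine ⟨fun i hi hi' => ?_, fun i hi hi' => by omega⟩
        rw [h i hi hi']
        tauto
    · have hn : m * j < m * N := Nat.mul_lt_mul_of_pos_left hlt hm
      rw [Ecnt, Ecnt, if_pos (by omega), if_pos (by omega)]
      classical
      rw [Nat.card_congr (Equiv.subtypeEquivRight fun σ => Xset_iff_D hm σ hj0 hn)]
      simp only [Nat.card_eq_fintype_card]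
      apply Fintype.card_subtype_or_disjoint
      rw [Pi.disjoint_iff]
      intro σ
      rw [Prop.disjoint_iff]
      have := D_disj hm σ hj0 hn
      tauto

theorem alt_sum (E : ℕ → ℚ) (N : ℕ) :
    ∑ j ∈ Finset.range (N + 1), (-1 : ℚ) ^ j * (E j + E (j + 1)) =
      E 0 + (-1) ^ N * E (N + 1) := by
  induction N with
  | zero => simp
  | succ N ih =>
    rw [Finset.sum_range_succ, ih]
    ring

theorem statement14_aux (m N : ℕ) (hm : 1 ≤ m) (hN : 1 ≤ N) :
    ∑ j ∈ Finset.range (N + 1), (-1 : ℚ) ^ (N - j) *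
      (1 / ((m * N - m * j).factorial : ℚ) * (rCount m (m * j) / (m * j).factorial)) = 0 := by
  have h : ∀ j ∈ Finset.range (N + 1), (-1 : ℚ) ^ (N - j) *
      (1 / ((m * N - m * j).factorial : ℚ) * (rCount m (m * j) / (m * j).factorial)) =
      ((-1) ^ N / (m * N).factorial) *
        ((-1) ^ j * ((Ecnt m N j : ℚ) + (Ecnt m N (j + 1) : ℚ))) := by
    intro j hj
    have hj : j ≤ N := by simpa [Nat.lt_succ_iff] using hj
    have hle : m * j ≤ m * N := Nat.mul_le_mul_left _ hj
    rw [term_eq (n := m * N) (by omega) (dvd_mul_right _ _), X_eq_E hm hN hj]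
    have : (-1 : ℚ) ^ (N - j) = (-1) ^ N * (-1) ^ j := by
      obtain ⟨k, rfl⟩ := Nat.exists_eq_add_of_le hj
      have h1 : ((-1 : ℚ) ^ j) * (-1) ^ j = 1 := by
        rw [← mul_pow]; simp
      rw [Nat.add_sub_cancel_left, pow_add]
      linear_combination (-(-1 : ℚ) ^ k) * h1
    rw [this]
    push_cast
    ring
  rw [Finset.sum_congr rfl h, ← Finset.mul_sum, alt_sum (fun j => (Ecnt m N j : ℚ))]
  simp [Ecnt]

/-- for `m ≥ 1`, in `ℚ⟦X⟧`,
`(Σ_k (−1)ᵏ·X^{mk}/(mk)!) · (Σₙ rₘ(n)·Xⁿ/n!) = 1`. -/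
theorem statement14 (m : ℕ) (hm : 1 ≤ m) :
    (PowerSeries.mk (fun n : ℕ =>
        if m ∣ n then ((-1 : ℚ)) ^ (n / m) / n.factorial else 0)) *
      (PowerSeries.mk (fun n : ℕ => (rCount m n : ℚ) / n.factorial)) = 1 := by
  ext n
  rw [mul_comm, PowerSeries.coeff_mul, PowerSeries.coeff_one]
  simp only [PowerSeries.coeff_mk]
  rw [Finset.Nat.sum_antidiagonal_eq_sum_range_succ_mk]
  simp only
  by_cases hn : m ∣ n
  · obtain ⟨N, rfl⟩ := hn
    rcases Nat.eq_zero_or_pos N with rfl | hN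
    · have : Nat.card {σ // Rset m 0 σ} = 1 := by
        rw [Nat.card_eq_one_iff_unique]
        exact ⟨inferInstance, ⟨⟨1, fun i _ h => absurd h (Nat.not_lt_zero _)⟩⟩⟩
      simp [rCount_eq (dvd_zero m), this]
    · rw [if_neg (Nat.mul_pos hm hN).ne', ← statement14_aux m N hm hN]
      symm
      refine Finset.sum_of_injOn (fun j => m * j) ?_ ?_ ?_ ?_
      · intro x _ y _ hxy
        exact Nat.eq_of_mul_eq_mul_left hm hxy
      · intro x hx
        have hx : x ≤ N := by simpa [Nat.lt_succ_iff] using hx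
        have := Nat.mul_le_mul_left m hx
        simpa [Nat.lt_succ_iff] using this
      · intro i hi hi'
        have hi : i ≤ m * N := by simpa [Nat.lt_succ_iff] using hi
        have : ¬ m ∣ i := by
          rintro ⟨k, rfl⟩
          apply hi'
          refine ⟨k, ?_, rfl⟩
          have := Nat.le_of_mul_le_mul_left hi hm
          simpa [Nat.lt_succ_iff] using this
        simp [rCount, this]
      · intro j hj
        rw [← Nat.mul_sub, if_pos (dvd_mul_right _ _), Nat.mul_div_cancel_left _ hm]
        ring
  · rw [if_neg (by rintro rfl; exact hn (dvd_zero m))]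
    refine Finset.sum_eq_zero fun i hi => ?_
    have hi : i ≤ n := by simpa [Nat.lt_succ_iff] using hi
    by_cases h1 : m ∣ i
    · rw [if_neg, mul_zero]
      intro h2
      apply hn
      have := dvd_add h1 h2
      rwa [Nat.add_sub_cancel' hi] at this
    · simp [rCount, h1]
end

section
/- For all integers n ≥ 0 and k ≥ 0, the following identity holds in the polynomial ring ℚ[q]: Σ_{π ∈ Sₙ, altdes(π) ≤ k} q^{altmaj(π)} · (Σ_{0 ≤ i₁ ≤ i₂ ≤ ⋯ ≤ i_{k−altdes(π)} ≤ n} q^{i₁+⋯+i_{k−altdes(π)}}) = Σ_{(m₀,m₁,…,m_k) ∈ ℕ^{k+1}, m₀+⋯+m_k = n} (n!/(m₀!·m₁!·⋯·m_k!)) · E_{m₀}·E_{m₁}·⋯·E_{m_k} · q^{0·m₀+1·m₁+2·m₂+⋯+k·m_k}. (This is the identity obtained by extracting the coefficient of tᵏ·xⁿ/n! in Remmel's generating function Σₙ (xⁿ/n!)·(Σ_{π∈Sₙ} t^{altdes(π)} q^{altmaj(π)})/((1−t)(1−tq)⋯(1−tqⁿ)) = Σ_k tᵏ Π_{j=0}^k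 (sec(xqʲ)+tan(xqʲ)).) -/
/-- The number of alternating descents of `σ`. -/
def altdes {n : ℕ} (σ : Equiv.Perm (Fin n)) : ℕ :=
  ((Finset.range n).filter (fun i => IsAltDescent σ i)).card

/-- The alternating major index of `σ`: the sum of the alternating descents. -/
def altmaj {n : ℕ} (σ : Equiv.Perm (Fin n)) : ℕ :=
  ∑ i ∈ (Finset.range n).filter (fun i => IsAltDescent σ i), i

/-- The complete homogeneous symmetric polynomial `h_j(1, q, q², …, qⁿ)` in `ℚ[q]`:
the sum of `q^{i₁+⋯+i_j}` over `0 ≤ i₁ ≤ ⋯ ≤ i_j ≤ n`. -/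
noncomputable def hPoly (n j : ℕ) : Polynomial ℚ :=
  ∑ F ∈ Finset.univ.filter (fun F : Fin j → Fin (n + 1) => ∀ a b, a ≤ b → F a ≤ F b),
    Polynomial.X ^ (∑ i, (F i : ℕ))


open Polynomial in
lemma hPoly_zero (n : ℕ) : hPoly n 0 = 1 := by
  simp [hPoly]

lemma hPoly_succ (n j : ℕ) :
    hPoly n (j + 1) = ∑ a ∈ Finset.range (n + 1), Polynomial.X ^ a * hPoly a j := by
  unfold hPoly
  simp_rw [Finset.mul_sum]
  rw [Finset.sum_sigma']
  symm
  refine Finset.sum_bij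
    (fun (p : (a : ℕ) × (Fin j → Fin (a + 1))) hp =>
      (fun i : Fin (j + 1) => if h : (i : ℕ) < j then
        (⟨(p.2 ⟨i, h⟩ : ℕ), by
          have h1 := (p.2 ⟨i, h⟩).2
          have h2 := (Finset.mem_sigma.1 hp).1
          rw [Finset.mem_range] at h2
          omega⟩ : Fin (n + 1))
        else ⟨p.1, by simpa using (Finset.mem_sigma.1 hp).1⟩)) ?_ ?_ ?_ ?_
  · rintro ⟨a, F⟩ hp
    simp only [Finset.mem_sigma, Finset.mem_filter, Finset.mem_univ, true_and] at hp ⊢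
    intro x y hxy
    by_cases hy : (y : ℕ) < j
    · have hx : (x : ℕ) < j := lt_of_le_of_lt hxy hy
      simp only [hx, hy, dif_pos, Fin.mk_le_mk]
      exact hp.2 ⟨x, hx⟩ ⟨y, hy⟩ hxy
    · by_cases hx : (x : ℕ) < j
      · simp only [hx, hy, dif_pos, dif_neg, Fin.mk_le_mk, not_false_eq_true]
        have := (F ⟨x, hx⟩).2
        omega
      · simp [hx, hy]
  · rintro ⟨a, F⟩ hp ⟨b, G⟩ hq h
    have h0 := congrFun h (Fin.last j)
    simp at h0
    subst h0
    congr 1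
    funext i
    have h1 := congrFun h i.castSucc
    simp at h1
    exact Fin.ext h1
  · intro F hF
    simp only [Finset.mem_filter, Finset.mem_univ, true_and] at hF
    refine ⟨⟨(F (Fin.last j) : ℕ), fun i => ⟨(F i.castSucc : ℕ), ?_⟩⟩, ?_, ?_⟩
    · have := hF i.castSucc (Fin.last j) (Fin.le_last _)
      rw [Fin.le_def] at this
      omega
    · simp only [Finset.mem_sigma, Finset.mem_filter, Finset.mem_univ, true_and, Finset.mem_range]
      refine ⟨(F (Fin.last j)).2, fun a b hab => ?_⟩
      rw [Fin.mk_le_mk]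
      exact hF _ _ (by simpa using hab)
    · funext i
      by_cases hi : (i : ℕ) < j
      · simp [hi]
      · have : i = Fin.last j := by ext; simp; omega
        subst this
        simp
  · rintro ⟨a, F⟩ hp
    rw [← pow_add, Fin.sum_univ_castSucc]
    congr 1
    simp [add_comm]

/-- weight of a descent set -/
noncomputable def wPoly (k n : ℕ) (D : Finset ℕ) : Polynomial ℚ :=
  if D.card ≤ k then Polynomial.X ^ (∑ i ∈ D, i) * hPoly n (k - D.card) else 0

lemma wPoly_zero (n : ℕ) (D : Finset ℕ) : wPoly 0 n D = if D = ∅ then 1 else 0 := by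
  unfold wPoly
  by_cases h : D = ∅
  · simp [h, hPoly_zero]
  · have : ¬ D.card ≤ 0 := by simpa using h
    simp [h]

lemma wPoly_succ (k n : ℕ) (D : Finset ℕ) (hD : ∀ d ∈ D, d ≤ n) :
    wPoly (k + 1) n D = ∑ a ∈ Finset.range (n + 1),
      if ∀ d ∈ D, d ≤ a then Polynomial.X ^ a * wPoly k a (D.erase a) else 0 := by
  rcases D.eq_empty_or_nonempty with rfl | hne
  · simp [wPoly, hPoly_succ]
  · set d := D.max' hne with hd
    have hdD : d ∈ D := D.max'_mem hne
    have hmax : ∀ x ∈ D, x ≤ d := fun x hx => D.le_max' x hx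
    have hiff : ∀ a, (∀ x ∈ D, x ≤ a) ↔ d ≤ a :=
      fun a => ⟨fun h => h d hdD, fun h x hx => (hmax x hx).trans h⟩
    simp_rw [hiff]
    have hdn := hD d hdD
    have hcard : (D.erase d).card + 1 = D.card := Finset.card_erase_add_one hdD
    have hsum : (∑ i ∈ D.erase d, i) + d = ∑ i ∈ D, i := Finset.sum_erase_add D (fun i => i) hdD
    obtain ⟨e, rfl⟩ := Nat.exists_eq_add_of_le hdn
    have key : ∀ e, wPoly (k + 1) (d + e) D = ∑ a ∈ Finset.range (d + e + 1),
      if d ≤ a then Polynomial.X ^ a * wPoly k a (D.erase a) else 0 := by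
      intro e
      induction e with
      | zero =>
        rw [add_zero, Finset.sum_range_succ, Finset.sum_eq_zero, zero_add, if_pos le_rfl]
        · unfold wPoly
          by_cases h : D.card ≤ k + 1
          · rw [if_pos h, if_pos (by omega), ← mul_assoc, ← pow_add, ← hsum, add_comm d]
            congr 2
            omega
          · rw [if_neg h, if_neg (by omega), mul_zero]
        · intro x hx
          rw [Finset.mem_range] at hx
          rw [if_neg (by omega)]
      | succ e ih =>
        rw [Finset.sum_range_succ, ← add_assoc d e 1, ← ih, if_pos (by omega),
          Finset.erase_eq_of_notMem (fun h => by have := hmax _ h; omega)]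
        unfold wPoly
        by_cases h : D.card ≤ k
        · rw [if_pos h, if_pos (by omega), if_pos (by omega), Nat.succ_sub h, hPoly_succ, hPoly_succ,
            Finset.sum_range_succ _ (d + e + 1)]
          ring
        · by_cases h' : D.card ≤ k + 1
          · rw [if_pos h', if_neg h, if_pos h']
            have : k + 1 - D.card = 0 := by omega
            simp [this, hPoly_zero]
          · simp [h, h']
    exact key e

/-- right hand side -/
noncomputable def rPoly (k n : ℕ) : Polynomial ℚ :=
  ∑ m ∈ Finset.Nat.antidiagonalTuple (k + 1) n,
        Polynomial.C ((Nat.multinomial Finset.univ m : ℚ) * ∏ i, (eulerNum (m i) : ℚ)) *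
          Polynomial.X ^ (∑ i : Fin (k + 1), (i : ℕ) * m i)

lemma rPoly_zero (n : ℕ) : rPoly 0 n = Polynomial.C (eulerNum n : ℚ) := by
  simp [rPoly]

lemma multinomial_fin_succ (k : ℕ) (m : Fin (k + 1) → ℕ) :
    Nat.multinomial Finset.univ m =
      (∑ i, m i).choose (∑ i : Fin k, m i.succ) * Nat.multinomial Finset.univ (fun i : Fin k => m i.succ) := by
  have h1 := Nat.multinomial_spec Finset.univ m
  have h2 := Nat.multinomial_spec Finset.univ (fun i : Fin k => m i.succ)
  rw [Fin.prod_univ_succ] at h1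
  have h3 := Nat.choose_mul_factorial_mul_factorial
    (show ∑ i : Fin k, m i.succ ≤ ∑ i, m i by rw [Fin.sum_univ_succ]; omega)
  have h4 : ∑ i, m i - ∑ i : Fin k, m i.succ = m 0 := by rw [Fin.sum_univ_succ]; omega
  rw [h4, ← h2, ← h1] at h3
  have hpos : 0 < (m 0).factorial * ∏ i : Fin k, (m i.succ).factorial :=
    Nat.mul_pos (Nat.factorial_pos _) (Finset.prod_pos fun _ _ => Nat.factorial_pos _)
  apply Nat.eq_of_mul_eq_mul_left hpos
  rw [← h3]
  ring

lemma rPoly_succ (k n : ℕ) :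
    rPoly (k + 1) n = ∑ a ∈ Finset.range (n + 1), Polynomial.X ^ a *
      (Polynomial.C ((n.choose a : ℚ) * eulerNum (n - a)) * rPoly k a) := by
  unfold rPoly
  simp_rw [Finset.mul_sum]
  rw [Finset.sum_sigma']
  symm
  refine Finset.sum_bij' (fun p _ => (Fin.cons (n - p.1) p.2 : Fin (k + 2) → ℕ))
    (fun m _ => ⟨∑ i : Fin (k + 1), m i.succ, fun i => m i.succ⟩) ?_ ?_ ?_ ?_ ?_
  · rintro ⟨a, m⟩ h
    simp only [Finset.mem_sigma, Finset.mem_range, Finset.Nat.mem_antidiagonalTuple] at h ⊢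
    rw [Fin.sum_univ_succ]
    simp
    omega
  · intro m h
    simp only [Finset.mem_sigma, Finset.mem_range, Finset.Nat.mem_antidiagonalTuple] at h ⊢
    rw [Fin.sum_univ_succ] at h
    exact ⟨by omega, trivial⟩
  · rintro ⟨a, m⟩ h
    simp only [Finset.mem_sigma, Finset.mem_range, Finset.Nat.mem_antidiagonalTuple] at h
    simp [h.2]
  · intro m h
    rw [Finset.Nat.mem_antidiagonalTuple, Fin.sum_univ_succ] at h
    funext i
    refine Fin.cases ?_ (fun i => ?_) i
    · simp; omega
    · simp
  · rintro ⟨a, m⟩ h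
    simp only [Finset.mem_sigma, Finset.mem_range, Finset.Nat.mem_antidiagonalTuple] at h
    rw [multinomial_fin_succ (k + 1), Fin.prod_univ_succ (n := k + 1), Fin.sum_univ_succ (n := k + 1),
      Fin.sum_univ_succ (n := k + 1)]
    simp only [Fin.cons_zero, Fin.cons_succ, h.2, Fin.val_zero, zero_mul, Fin.val_succ, add_mul,
      one_mul, Finset.sum_add_distrib]
    rw [show n - a + a = n by omega, pow_add]
    simp only [Polynomial.C_mul, Nat.cast_mul]
    ring

/-- the permutation whose first `a` entries form the set `S`, arranged as `τ`, and whose last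
`b` entries are arranged as `ρ` -/
noncomputable def glue {a b : ℕ}
    (p : {S : Finset (Fin (a + b)) // S.card = a} × Equiv.Perm (Fin a) × Equiv.Perm (Fin b)) :
    Equiv.Perm (Fin (a + b)) :=
  finSumFinEquiv.symm.trans ((Equiv.sumCongr p.2.1 p.2.2).trans
    (finSumEquivOfFinset p.1.2 (by rw [Finset.card_compl, p.1.2, Fintype.card_fin]; omega)))

lemma compl_card {a b : ℕ} (S : {S : Finset (Fin (a + b)) // S.card = a}) : S.1ᶜ.card = b := by
  rw [Finset.card_compl, S.2, Fintype.card_fin]; omega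

lemma glue_left {a b : ℕ}
    (p : {S : Finset (Fin (a + b)) // S.card = a} × Equiv.Perm (Fin a) × Equiv.Perm (Fin b))
    (i : Fin a) : glue p (Fin.castAdd b i) = p.1.1.orderEmbOfFin p.1.2 (p.2.1 i) := by
  simp [glue]

lemma glue_right {a b : ℕ}
    (p : {S : Finset (Fin (a + b)) // S.card = a} × Equiv.Perm (Fin a) × Equiv.Perm (Fin b))
    (i : Fin b) : glue p (Fin.natAdd a i) = p.1.1ᶜ.orderEmbOfFin (compl_card p.1) (p.2.2 i) := by
  simp [glue]

lemma glue_injective (a b : ℕ) : Function.Injective (glue (a := a) (b := b)) := by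
  rintro ⟨⟨S, hS⟩, τ, ρ⟩ ⟨⟨S', hS'⟩, τ', ρ'⟩ h
  have hmem : ∀ (p : {S : Finset (Fin (a + b)) // S.card = a} × Equiv.Perm (Fin a) × Equiv.Perm (Fin b)),
      p.1.1 = Finset.univ.image (fun i : Fin a => glue p (Fin.castAdd b i)) := by
    intro p
    symm
    apply Finset.eq_of_subset_of_card_le
    · intro x hx
      obtain ⟨i, -, rfl⟩ := Finset.mem_image.1 hx
      rw [glue_left]
      exact Finset.orderEmbOfFin_mem _ _ _
    · rw [Finset.card_image_of_injective, p.1.2]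
      · simp
      · intro i j hij
        simpa using hij
  have hSS : S = S' := by
    have h1 := hmem ⟨⟨S, hS⟩, τ, ρ⟩
    have h2 := hmem ⟨⟨S', hS'⟩, τ', ρ'⟩
    rw [h] at h1
    exact h1.trans h2.symm
  subst hSS
  have h1 : τ = τ' := by
    ext i
    have h1 := glue_left ⟨⟨S, hS⟩, τ, ρ⟩ i
    rw [h, glue_left] at h1
    rw [(S.orderEmbOfFin hS).injective h1]
  have h2 : ρ = ρ' := by
    ext i
    have h1 := glue_right ⟨⟨S, hS⟩, τ, ρ⟩ i
    rw [h, glue_right] at h1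
    rw [(Sᶜ.orderEmbOfFin _).injective h1]
  rw [h1, h2]

lemma glue_bijective (a b : ℕ) : Function.Bijective (glue (a := a) (b := b)) := by
  rw [Fintype.bijective_iff_injective_and_card]
  refine ⟨glue_injective a b, ?_⟩
  rw [Fintype.card_prod, Fintype.card_prod, Fintype.card_perm, Fintype.card_perm, Fintype.card_perm,
    Fintype.card_finset_len]
  simp only [Fintype.card_fin]
  have := Nat.choose_mul_factorial_mul_factorial (show a ≤ a + b by omega)
  rw [Nat.add_sub_cancel_left] at this
  rw [← this, mul_assoc]

lemma permEnt_of {n : ℕ} (σ : Equiv.Perm (Fin n)) (i : ℕ) (h : i < n) :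
    permEnt σ (i + 1) = (σ ⟨i, h⟩ : ℕ) + 1 := by
  unfold permEnt
  rw [dif_pos ⟨by omega, by omega⟩]
  rfl

lemma permEnt_ne {n : ℕ} (σ : Equiv.Perm (Fin n)) (i : ℕ) (h : 1 ≤ i) (h' : i < n) :
    permEnt σ i ≠ permEnt σ (i + 1) := by
  obtain ⟨i, rfl⟩ := Nat.exists_eq_add_of_le' h
  rw [permEnt_of σ i (by omega), permEnt_of σ (i + 1) h']
  intro h
  have h2 := σ.injective (Fin.ext (Nat.succ.inj h))
  simp at h2

lemma glue_lt_left {a b : ℕ}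
    (p : {S : Finset (Fin (a + b)) // S.card = a} × Equiv.Perm (Fin a) × Equiv.Perm (Fin b))
    (i j : ℕ) (hi : 1 ≤ i) (hi' : i ≤ a) (hj : 1 ≤ j) (hj' : j ≤ a) :
    permEnt (glue p) i < permEnt (glue p) j ↔ permEnt p.2.1 i < permEnt p.2.1 j := by
  obtain ⟨i, rfl⟩ := Nat.exists_eq_add_of_le' hi
  obtain ⟨j, rfl⟩ := Nat.exists_eq_add_of_le' hj
  rw [permEnt_of _ i (by omega), permEnt_of _ j (by omega), permEnt_of _ i (by omega),
    permEnt_of _ j (by omega)]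
  have h1 := glue_left p ⟨i, by omega⟩
  have h2 := glue_left p ⟨j, by omega⟩
  simp only [Fin.castAdd_mk] at h1 h2
  rw [h1, h2, Nat.add_lt_add_iff_right, Nat.add_lt_add_iff_right, ← Fin.lt_def, ← Fin.lt_def]
  exact (p.1.1.orderEmbOfFin p.1.2).lt_iff_lt

lemma glue_lt_right {a b : ℕ}
    (p : {S : Finset (Fin (a + b)) // S.card = a} × Equiv.Perm (Fin a) × Equiv.Perm (Fin b))
    (i j : ℕ) (hi : 1 ≤ i) (hi' : i ≤ b) (hj : 1 ≤ j) (hj' : j ≤ b) :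
    permEnt (glue p) (a + i) < permEnt (glue p) (a + j) ↔ permEnt p.2.2 i < permEnt p.2.2 j := by
  obtain ⟨i, rfl⟩ := Nat.exists_eq_add_of_le' hi
  obtain ⟨j, rfl⟩ := Nat.exists_eq_add_of_le' hj
  rw [← add_assoc, ← add_assoc, permEnt_of _ (a + i) (by omega), permEnt_of _ (a + j) (by omega),
    permEnt_of _ i (by omega), permEnt_of _ j (by omega)]
  have h1 := glue_right p ⟨i, by omega⟩
  have h2 := glue_right p ⟨j, by omega⟩
  simp only [Fin.natAdd_mk] at h1 h2
  rw [h1, h2, Nat.add_lt_add_iff_right, Nat.add_lt_add_iff_right, ← Fin.lt_def, ← Fin.lt_def]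
  exact (p.1.1ᶜ.orderEmbOfFin (compl_card p.1)).lt_iff_lt

/-- no alternating descent, when positions are shifted by `a` -/
def NoAlt (a : ℕ) {m : ℕ} (ρ : Equiv.Perm (Fin m)) : Prop :=
  ∀ i, 1 ≤ i → i < m → ((a + i) % 2 = 1 → permEnt ρ i < permEnt ρ (i + 1)) ∧
    ((a + i) % 2 = 0 → permEnt ρ (i + 1) < permEnt ρ i)

lemma permEnt_rev {m : ℕ} (ρ : Equiv.Perm (Fin m)) (i : ℕ) (h : 1 ≤ i) (h' : i ≤ m) :
    permEnt (ρ.trans Fin.revPerm) i + permEnt ρ i = m + 1 := by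
  obtain ⟨i, rfl⟩ := Nat.exists_eq_add_of_le' h
  rw [permEnt_of _ i (by omega), permEnt_of _ i (by omega)]
  simp [Fin.val_rev]
  omega

lemma noAlt_iff_odd (a : ℕ) {m : ℕ} (ha : a % 2 = 1) (ρ : Equiv.Perm (Fin m)) :
    NoAlt a ρ ↔ IsAltPerm ρ := by
  unfold NoAlt IsAltPerm
  refine forall_congr' fun i => forall_congr' fun h1 => forall_congr' fun h2 => ?_
  rw [show (a + i) % 2 = 1 ↔ i % 2 = 0 by omega, show (a + i) % 2 = 0 ↔ i % 2 = 1 by omega, and_comm]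

lemma noAlt_iff_even (a : ℕ) {m : ℕ} (ha : a % 2 = 0) (ρ : Equiv.Perm (Fin m)) :
    NoAlt a ρ ↔ IsAltPerm (ρ.trans Fin.revPerm) := by
  unfold NoAlt IsAltPerm
  refine forall_congr' fun i => forall_congr' fun h1 => forall_congr' fun h2 => ?_
  have e1 := permEnt_rev ρ i (by omega) (by omega)
  have e2 := permEnt_rev ρ (i + 1) (by omega) (by omega)
  constructor
  · rintro ⟨h, h'⟩
    constructor
    · intro hi
      have := h (by omega)
      omega
    · intro hi
      have := h' (by omega)
      omega
  · rintro ⟨h, h'⟩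
    constructor
    · intro hi
      have := h (by omega)
      omega
    · intro hi
      have := h' (by omega)
      omega

lemma card_noAlt (a m : ℕ) : Nat.card {ρ : Equiv.Perm (Fin m) // NoAlt a ρ} = eulerNum m := by
  unfold eulerNum
  rcases Nat.mod_two_eq_zero_or_one a with h | h
  · apply Nat.card_congr
    refine Equiv.subtypeEquiv (Equiv.mulLeft Fin.revPerm) fun ρ => ?_
    exact noAlt_iff_even a h ρ
  · exact Nat.card_congr (Equiv.subtypeEquivRight fun ρ => noAlt_iff_odd a h ρ)

/-- the alternating descent set -/
def altSet {n : ℕ} (σ : Equiv.Perm (Fin n)) : Finset ℕ :=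
  (Finset.range n).filter (fun i => IsAltDescent σ i)

lemma mem_altSet {n : ℕ} (σ : Equiv.Perm (Fin n)) (i : ℕ) :
    i ∈ altSet σ ↔ 1 ≤ i ∧ i < n ∧
    ((i % 2 = 1 ∧ permEnt σ (i + 1) < permEnt σ i) ∨
     (i % 2 = 0 ∧ permEnt σ i < permEnt σ (i + 1))) := by
  unfold altSet
  rw [Finset.mem_filter, Finset.mem_range]
  unfold IsAltDescent
  tauto

lemma altSet_eq_empty {n : ℕ} (σ : Equiv.Perm (Fin n)) : altSet σ = ∅ ↔ NoAlt 0 σ := by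
  rw [Finset.eq_empty_iff_forall_notMem]
  refine forall_congr' fun i => ?_
  rw [mem_altSet, zero_add]
  constructor
  · intro h h1 h2
    have := permEnt_ne σ i h1 h2
    omega
  · rintro h ⟨h1, h2, h3⟩
    have := h h1 h2
    omega

lemma altSet_glue {a b : ℕ}
    (p : {S : Finset (Fin (a + b)) // S.card = a} × Equiv.Perm (Fin a) × Equiv.Perm (Fin b)) :
    (∀ d ∈ altSet (glue p), d ≤ a) ↔ NoAlt a p.2.2 := by
  constructor
  · intro h i h1 h2
    have h3 := mt (h (a + i)) (by omega)
    rw [mem_altSet, add_assoc, glue_lt_right p _ _ (by omega) (by omega) (by omega) (by omega),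
      glue_lt_right p _ _ (by omega) (by omega) (by omega) (by omega)] at h3
    have := permEnt_ne p.2.2 i h1 h2
    omega
  · intro h d hd
    by_contra hda
    obtain ⟨i, rfl⟩ := Nat.exists_eq_add_of_lt (not_le.1 hda)
    rw [mem_altSet, show a + i + 1 = a + (i + 1) by omega, add_assoc a (i + 1) 1] at hd
    obtain ⟨h1, h2, h3⟩ := hd
    rw [glue_lt_right p _ _ (by omega) (by omega) (by omega) (by omega),
      glue_lt_right p _ _ (by omega) (by omega) (by omega) (by omega)] at h3
    have := h (i + 1) (by omega) (by omega)
    omega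

lemma altSet_glue_erase {a b : ℕ}
    (p : {S : Finset (Fin (a + b)) // S.card = a} × Equiv.Perm (Fin a) × Equiv.Perm (Fin b))
    (h : ∀ d ∈ altSet (glue p), d ≤ a) : (altSet (glue p)).erase a = altSet p.2.1 := by
  ext i
  rw [Finset.mem_erase]
  by_cases hi : 1 ≤ i ∧ i < a
  · rw [mem_altSet, mem_altSet, glue_lt_left p _ _ (by omega) (by omega) (by omega) (by omega),
      glue_lt_left p _ _ (by omega) (by omega) (by omega) (by omega)]
    omega
  · constructor
    · rintro ⟨h1, h2⟩
      have := h i h2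
      rw [mem_altSet] at h2
      omega
    · intro h2
      rw [mem_altSet] at h2
      omega

/-- left hand side -/
noncomputable def lPoly (k n : ℕ) : Polynomial ℚ :=
  ∑ σ : Equiv.Perm (Fin n), wPoly k n (altSet σ)

open Classical in
lemma sum_noAlt (a m : ℕ) (P : Polynomial ℚ) :
    ∑ ρ : Equiv.Perm (Fin m), (if NoAlt a ρ then P else 0) = Polynomial.C (eulerNum m : ℚ) * P := by
  rw [← Finset.sum_filter, Finset.sum_const, ← card_noAlt a m, Nat.card_eq_fintype_card,
    Fintype.card_subtype, nsmul_eq_mul]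
  simp

lemma lPoly_zero (n : ℕ) : lPoly 0 n = Polynomial.C (eulerNum n : ℚ) := by
  classical
  unfold lPoly
  simp_rw [wPoly_zero, altSet_eq_empty]
  rw [← mul_one (Polynomial.C _), ← sum_noAlt 0 n 1]

lemma lPoly_aux (k a b : ℕ) :
    ∑ σ : Equiv.Perm (Fin (a + b)), (if ∀ d ∈ altSet σ, d ≤ a then
      Polynomial.X ^ a * wPoly k a ((altSet σ).erase a) else 0) =
    Polynomial.X ^ a * (Polynomial.C (((a + b).choose a : ℚ) * eulerNum b) * lPoly k a) := by
  classical
  rw [← (Equiv.ofBijective _ (glue_bijective a b)).sum_comp]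
  have : ∀ p : {S : Finset (Fin (a + b)) // S.card = a} × Equiv.Perm (Fin a) × Equiv.Perm (Fin b),
      (if ∀ d ∈ altSet (Equiv.ofBijective _ (glue_bijective a b) p), d ≤ a then
      Polynomial.X ^ a * wPoly k a ((altSet (Equiv.ofBijective _ (glue_bijective a b) p)).erase a)
        else 0) = if NoAlt a p.2.2 then Polynomial.X ^ a * wPoly k a (altSet p.2.1) else 0 := by
    intro p
    rw [Equiv.ofBijective_apply]
    by_cases h : ∀ d ∈ altSet (glue p), d ≤ a
    · rw [if_pos h, if_pos ((altSet_glue p).1 h), altSet_glue_erase p h]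
    · rw [if_neg h, if_neg (mt (altSet_glue p).2 h)]
  simp_rw [this]
  rw [Fintype.sum_prod_type]
  simp_rw [Fintype.sum_prod_type, sum_noAlt]
  rw [Finset.sum_const, Finset.card_univ, Fintype.card_finset_len, Fintype.card_fin]
  unfold lPoly
  simp_rw [← Finset.mul_sum]
  rw [nsmul_eq_mul]
  simp
  ring

lemma lPoly_succ (k n : ℕ) :
    lPoly (k + 1) n = ∑ a ∈ Finset.range (n + 1), Polynomial.X ^ a *
      (Polynomial.C ((n.choose a : ℚ) * eulerNum (n - a)) * lPoly k a) := by
  rw [lPoly]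
  rw [Finset.sum_congr rfl fun σ _ => wPoly_succ k n (altSet σ) fun d hd => by
    rw [mem_altSet] at hd; omega]
  rw [Finset.sum_comm]
  refine Finset.sum_congr rfl fun a ha => ?_
  rw [Finset.mem_range] at ha
  obtain ⟨b, rfl⟩ := Nat.exists_eq_add_of_le (show a ≤ n by omega)
  rw [lPoly_aux, Nat.add_sub_cancel_left]

lemma lPoly_eq_rPoly (k n : ℕ) : lPoly k n = rPoly k n := by
  induction k generalizing n with
  | zero => rw [lPoly_zero, rPoly_zero]
  | succ k ih =>
    rw [lPoly_succ, rPoly_succ]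
    simp_rw [ih]

/-- the identity in `ℚ[q]` obtained by extracting the coefficient of
`tᵏ·xⁿ/n!` in Remmel's generating function for the joint distribution of `altdes` and
`altmaj`. -/
theorem statement19 (n k : ℕ) :
    ∑ σ ∈ Finset.univ.filter (fun σ : Equiv.Perm (Fin n) => altdes σ ≤ k),
        Polynomial.X ^ altmaj σ * hPoly n (k - altdes σ) =
      ∑ m ∈ Finset.Nat.antidiagonalTuple (k + 1) n,
        Polynomial.C ((Nat.multinomial Finset.univ m : ℚ) * ∏ i, (eulerNum (m i) : ℚ)) *
          Polynomial.X ^ (∑ i : Fin (k + 1), (i : ℕ) * m i) := by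
  rw [Finset.sum_filter]
  exact lPoly_eq_rPoly k n
end
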